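/- Let C and D be F_4-linear cyclic codes of length n with parameters [n,k_1,d_1]_4 and [n,k_2,d_2]_4 respectively, with C ⊆ D. Then there exists an asymmetric quantum code with parameters ((n, 4^{k_2−k_1}, d_z/d_x))_4, where {d_z, d_x} = {d(C^⊥H), d_2}. -/

import Mathlib

open scoped Classical

noncomputable section

namespace AQC

/-- Hamming weight of a vector: the number of nonzero entries. -/
def wt {n : ℕ} {α : Type*} [Zero α] (u : Fin n → α) : ℕ :=
  (Finset.univ.filter (fun i => u i ≠ 0)).card

variable (p m n : ℕ) [Fact p.Prime]

instance : Fintype (GaloisField p m) := Fintype.ofFinite _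

/-- Words of length `n` over the field `F_q` with `q = p ^ m`. -/
abbrev Word := Fin n → GaloisField p m

/-- The usual dot product `u · v = ∑ i, u i * v i` on `F_q ^ n`. -/
def dotW (u v : Word p m n) : GaloisField p m := ∑ i, u i * v i

/-- The state space `V_n = ℂ^(F_q^n)`. -/
abbrev QV := Word p m n → ℂ

/-- The trace map `T : F_q → F_p`. -/
def gfTr (x : GaloisField p m) : ZMod p := Algebra.trace (ZMod p) (GaloisField p m) x

/-- `η = exp(2πi/p)`, a primitive `p`-th root of unity. -/
def eta : ℂ := Complex.exp (2 * Real.pi * Complex.I / p)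

/-- The additive character `x ↦ η ^ x` of `F_p`. -/
def chi (x : ZMod p) : ℂ := eta p ^ x.val

/-- The Hermitian inner product `⟨u|v⟩ = ∑ c, conj (u c) * v c` on the state space. -/
def hInner (u v : QV p m n) : ℂ := ∑ c, (starRingEnd ℂ) (u c) * v c

/-- The error operator `e = X(a)Z(b)`, acting by `e|c⟩ = η^{T(b·c)} |a+c⟩`. -/
def errOp (a b : Word p m n) : QV p m n →ₗ[ℂ] QV p m n where
  toFun f := fun x => chi p (gfTr p m (dotW p m n b (x - a))) * f (x - a)
  map_add' f g := by funext x; simp [mul_add]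
  map_smul' c f := by funext x; simp; ring

/-- Purity of an asymmetric quantum code with parameters `((n,K,d_z/d_x))_q`. -/
def IsPureAQEC (Q : Submodule ℂ (QV p m n)) (dz dx : ℕ) : Prop :=
  ∀ u ∈ Q, ∀ v ∈ Q, ∀ a b : Word p m n,
    1 ≤ wt a → wt a ≤ dx - 1 → 1 ≤ wt b → wt b ≤ dz - 1 →
      hInner p m n u (errOp p m n a b v) = 0

/-- `Q` is an asymmetric quantum code with parameters `((n,K,d_z/d_x))_q`:
a `K`-dimensional subspace of `V_n` detecting `d_x - 1` qudits of `X`-errors and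
`d_z - 1` qudits of `Z`-errors; a code with `K = 1` is required to be pure. -/
def IsAQEC (Q : Submodule ℂ (QV p m n)) (K dz dx : ℕ) : Prop :=
  Module.finrank ℂ Q = K ∧ 1 ≤ K ∧
  (∀ u ∈ Q, ∀ v ∈ Q, hInner p m n u v = 0 →
    ∀ a b : Word p m n, wt a ≤ dx - 1 → wt b ≤ dz - 1 →
      hInner p m n u (errOp p m n a b v) = 0) ∧
  (K = 1 → IsPureAQEC p m n Q dz dx)

/-- Minimum distance of a set of words (`0` if the set has no nonzero element). -/
def minDistS {n : ℕ} {α : Type*} [Zero α] (S : Set (Fin n → α)) : ℕ :=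
  sInf {d | ∃ u ∈ S, u ≠ 0 ∧ wt u = d}

/-- Hermitian dual of an `F_4`-linear code. -/
def dualH (n : ℕ) (C : Submodule (GaloisField 2 2) (Word 2 2 n)) :
    Submodule (GaloisField 2 2) (Word 2 2 n) where
  carrier := {u | ∀ v ∈ C, ∑ i, u i * (v i) ^ 2 = 0}
  add_mem' := by
    intro u w hu hw v hv
    have h : ∑ i, (u + w) i * (v i) ^ 2 =
        (∑ i, u i * (v i) ^ 2) + ∑ i, w i * (v i) ^ 2 := by
      simp [← Finset.sum_add_distrib, add_mul]
    rw [h, hu v hv, hw v hv, add_zero]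
  zero_mem' := by intro v hv; simp
  smul_mem' := by
    intro c u hu v hv
    have h : ∑ i, (c • u) i * (v i) ^ 2 = c * ∑ i, u i * (v i) ^ 2 := by
      simp [Finset.mul_sum, mul_assoc]
    rw [h, hu v hv, mul_zero]


theorem wt_pos_of_ne {n : ℕ} {a : Word 2 2 n} (ha : a ≠ 0) : 1 ≤ wt a := by
  obtain ⟨i, hi⟩ := Function.ne_iff.mp ha
  exact Finset.card_pos.mpr ⟨i, by simpa using hi⟩

theorem minDistS_le {n : ℕ} {S : Set (Word 2 2 n)} {a : Word 2 2 n} (ha : a ∈ S) (h0 : a ≠ 0) :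
    minDistS S ≤ wt a := Nat.sInf_le ⟨a, ha, h0, rfl⟩

theorem eta_two : eta 2 = -1 := by
  unfold eta
  rw [← Complex.exp_pi_mul_I]
  congr 1
  push_cast
  ring

theorem chi_add (x y : ZMod 2) : chi 2 (x + y) = chi 2 x * chi 2 y := by
  unfold chi
  rw [eta_two]
  have h : ∀ x y : ZMod 2, (x + y).val = (x.val + y.val) % 2 := by decide
  rw [h, ← pow_add, ← neg_one_pow_eq_pow_mod_two]

theorem chi_one : chi 2 1 = -1 := by
  unfold chi
  rw [eta_two]
  have h : (1 : ZMod 2).val = 1 := by decide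
  rw [h, pow_one]

theorem chi_zero : chi 2 0 = 1 := by
  unfold chi
  simp

theorem dotW_add (n : ℕ) (b x y : Word 2 2 n) :
    dotW 2 2 n b (x + y) = dotW 2 2 n b x + dotW 2 2 n b y := by
  simp [dotW, mul_add, Finset.sum_add_distrib]

theorem dotW_smul (n : ℕ) (s : GaloisField 2 2) (b x : Word 2 2 n) :
    dotW 2 2 n b (s • x) = s * dotW 2 2 n b x := by
  simp only [dotW, Finset.mul_sum, Pi.smul_apply, smul_eq_mul]
  exact Finset.sum_congr rfl fun i _ => by ring

/-- The encoding map of the CSS code attached to `C ≤ D`. -/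
def cssMap {n : ℕ} (C D : Submodule (GaloisField 2 2) (Word 2 2 n)) :
    ((D ⧸ C.submoduleOf D) → ℂ) →ₗ[ℂ] QV 2 2 n where
  toFun g := fun x => if h : x ∈ D then g (Submodule.Quotient.mk ⟨x, h⟩) else 0
  map_add' f g := by funext x; by_cases h : x ∈ D <;> simp [h]
  map_smul' c f := by funext x; by_cases h : x ∈ D <;> simp [h]

theorem cssMap_inj {n : ℕ} (C D : Submodule (GaloisField 2 2) (Word 2 2 n)) :
    Function.Injective (cssMap C D) := by
  intro f g hfg
  funext q
  obtain ⟨⟨x, hx⟩, rfl⟩ := Submodule.Quotient.mk_surjective _ q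
  have := congrFun hfg x
  simpa [cssMap, hx] using this

theorem cssMap_not_mem {n : ℕ} (C D : Submodule (GaloisField 2 2) (Word 2 2 n))
    (f : (D ⧸ C.submoduleOf D) → ℂ) (x : Word 2 2 n) (hx : x ∉ D) : cssMap C D f x = 0 := by
  simp [cssMap, hx]

theorem cssMap_add {n : ℕ} (C D : Submodule (GaloisField 2 2) (Word 2 2 n)) (hsub : C ≤ D)
    (f : (D ⧸ C.submoduleOf D) → ℂ) (x c : Word 2 2 n) (hc : c ∈ C) :
    cssMap C D f (x + c) = cssMap C D f x := by
  by_cases hx : x ∈ D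
  · have hxc : x + c ∈ D := D.add_mem hx (hsub hc)
    simp only [cssMap, LinearMap.coe_mk, AddHom.coe_mk, hx, hxc, dite_true]
    congr 1
    rw [Submodule.Quotient.eq]
    simpa [Submodule.submoduleOf] using hc
  · have hxc : x + c ∉ D := fun h => hx (by simpa using D.sub_mem h (hsub hc))
    rw [cssMap_not_mem _ _ _ _ hx, cssMap_not_mem _ _ _ _ hxc]

theorem css_finrank {n : ℕ} (C D : Submodule (GaloisField 2 2) (Word 2 2 n)) (hsub : C ≤ D) :
    Module.finrank ℂ (LinearMap.range (cssMap C D)) =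
      4 ^ (Module.finrank (GaloisField 2 2) D - Module.finrank (GaloisField 2 2) C) := by
  rw [LinearMap.finrank_range_of_inj (cssMap_inj C D)]
  have : Fintype (D ⧸ C.submoduleOf D) := Fintype.ofFinite _
  rw [Module.finrank_fintype_fun_eq_card, ← Nat.card_eq_fintype_card,
    Module.natCard_eq_pow_finrank (K := GaloisField 2 2), GaloisField.card 2 2 two_ne_zero]
  have h1 := Submodule.finrank_quotient_add_finrank (C.submoduleOf D)
  rw [(Submodule.submoduleOfEquivOfLe hsub).finrank_eq] at h1
  rw [← h1, Nat.add_sub_cancel]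
  norm_num

theorem exists_trace_one {n : ℕ} (C : Submodule (GaloisField 2 2) (Word 2 2 n)) (b c : Word 2 2 n)
    (hc : c ∈ C) (hbc : dotW 2 2 n b c ≠ 0) :
    ∃ c' ∈ C, gfTr 2 2 (dotW 2 2 n b c') = 1 := by
  obtain ⟨y, hy⟩ := Algebra.trace_surjective (ZMod 2) (GaloisField 2 2) 1
  refine ⟨(y / dotW 2 2 n b c) • c, C.smul_mem _ hc, ?_⟩
  rw [dotW_smul, div_mul_cancel₀ _ hbc]
  exact hy

theorem css_isAQEC {n : ℕ} (C D : Submodule (GaloisField 2 2) (Word 2 2 n)) (hsub : C ≤ D)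
    (dz dx : ℕ) (hx : ∀ a ∈ D, a ≠ 0 → dx ≤ wt a)
    (hz : ∀ b : Word 2 2 n, (∀ c ∈ C, dotW 2 2 n b c = 0) → b ≠ 0 → dz ≤ wt b) :
    IsAQEC 2 2 n (LinearMap.range (cssMap C D))
      (4 ^ (Module.finrank (GaloisField 2 2) D - Module.finrank (GaloisField 2 2) C)) dz dx := by
  have key : ∀ u ∈ LinearMap.range (cssMap C D), ∀ v ∈ LinearMap.range (cssMap C D),
      ∀ a b : Word 2 2 n, a ≠ 0 → wt a ≤ dx - 1 → hInner 2 2 n u (errOp 2 2 n a b v) = 0 := by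
    rintro _ ⟨f, rfl⟩ _ ⟨g, rfl⟩ a b ha hwa
    have haD : a ∉ D := fun h => by
      have h1 := hx a h ha
      have h2 := wt_pos_of_ne ha
      omega
    refine Finset.sum_eq_zero fun x _ => ?_
    by_cases hxD : x ∈ D
    · have : x - a ∉ D := fun h => haD (by simpa using D.sub_mem hxD h)
      simp [errOp, cssMap_not_mem _ _ _ _ this]
    · simp [cssMap_not_mem _ _ _ _ hxD]
  refine ⟨css_finrank C D hsub, Nat.one_le_pow _ _ (by norm_num), ?_, ?_⟩
  · intro u hu v hv huv a b hwa hwb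
    by_cases ha : a ≠ 0
    · exact key u hu v hv a b ha hwa
    push Not at ha
    subst ha
    by_cases hb : b = 0
    · subst hb
      rw [← huv]
      refine Finset.sum_congr rfl fun x _ => ?_
      simp [errOp, dotW, gfTr, chi_zero]
    have hnb : ¬ ∀ c ∈ C, dotW 2 2 n b c = 0 := fun h => by
      have h1 := hz b h hb
      have h2 := wt_pos_of_ne hb
      omega
    push Not at hnb
    obtain ⟨c, hc, hbc⟩ := hnb
    obtain ⟨c, hc, hbc⟩ := exists_trace_one C b c hc hbc
    obtain ⟨f, rfl⟩ := hu
    obtain ⟨g, rfl⟩ := hv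
    have hneg : hInner 2 2 n (cssMap C D f) (errOp 2 2 n 0 b (cssMap C D g)) =
        - hInner 2 2 n (cssMap C D f) (errOp 2 2 n 0 b (cssMap C D g)) := by
      conv_lhs => unfold hInner
      rw [← Equiv.sum_comp (Equiv.addRight c)]
      unfold hInner
      rw [← Finset.sum_neg_distrib]
      refine Finset.sum_congr rfl fun x _ => ?_
      have ht : gfTr 2 2 (dotW 2 2 n b (x + c)) = gfTr 2 2 (dotW 2 2 n b x) + 1 := by
        rw [dotW_add, ← hbc]
        exact map_add (Algebra.trace (ZMod 2) (GaloisField 2 2)) _ _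
      simp only [errOp, LinearMap.coe_mk, AddHom.coe_mk, sub_zero, Equiv.coe_addRight,
        cssMap_add C D hsub _ x c hc, ht, chi_add, chi_one]
      ring
    exact self_eq_neg.mp hneg
  · intro _ u hu v hv a b ha1 ha2 _ _
    refine key u hu v hv a b ?_ ha2
    rintro rfl
    simp [wt] at ha1

/-- The dot product as a bilinear form. -/
def dotB (n : ℕ) : LinearMap.BilinForm (GaloisField 2 2) (Word 2 2 n) :=
  Matrix.toBilin' (1 : Matrix (Fin n) (Fin n) (GaloisField 2 2))

theorem dotB_apply {n : ℕ} (u v : Word 2 2 n) : dotB n u v = dotW 2 2 n u v := by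
  simp [dotB, Matrix.toBilin'_apply', dotW, dotProduct]

theorem dotW_comm {n : ℕ} (u v : Word 2 2 n) : dotW 2 2 n u v = dotW 2 2 n v u := by
  simp [dotW, mul_comm]

theorem dotB_refl (n : ℕ) : (dotB n).IsRefl := by
  intro u v h
  rw [dotB_apply] at h ⊢
  rw [dotW_comm, h]

theorem dotB_nondeg (n : ℕ) : (dotB n).Nondegenerate :=
  LinearMap.BilinForm.nondegenerate_toBilin'_of_det_ne_zero' _ (by simp)

theorem dual_wt {n : ℕ} (C : Submodule (GaloisField 2 2) (Word 2 2 n)) (b : Word 2 2 n)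
    (h : ∀ c ∈ C, dotW 2 2 n b c = 0) (hb : b ≠ 0) :
    minDistS ((dualH n C : Submodule (GaloisField 2 2) (Word 2 2 n)) : Set (Word 2 2 n)) ≤
      wt b := by
  have hw : wt (fun i => b i ^ 2) = wt b := by simp [wt]
  rw [← hw]
  refine minDistS_le ?_ ?_
  · intro v hv
    have h1 : (∑ i, b i * v i) ^ 2 = 0 := by
      have := h v hv
      unfold dotW at this
      rw [this]
      simp
    rw [sum_pow_char 2] at h1
    simpa [mul_pow] using h1
  · intro h0
    exact hb (by funext i; simpa using congrFun h0 i)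

/-- Theorem 7.1: nested `F_4`-linear cyclic codes
`C ⊆ D` with parameters `[n,k₁,d₁]_4` and `[n,k₂,d₂]_4` give an asymmetric quantum
code `((n, 4^{k₂-k₁}, d_z/d_x))_4` with `{d_z, d_x} = {d(C^⊥H), d₂}`. -/
theorem statement11 (n k₁ k₂ d₁ d₂ d' : ℕ) [NeZero n]
    (C D : Submodule (GaloisField 2 2) (Word 2 2 n))
    (hCcyc : ∀ u ∈ C, (fun i : Fin n => u (i - 1)) ∈ C)
    (hDcyc : ∀ u ∈ D, (fun i : Fin n => u (i - 1)) ∈ D)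
    (hk₁ : Module.finrank (GaloisField 2 2) C = k₁)
    (hk₂ : Module.finrank (GaloisField 2 2) D = k₂)
    (hd₁ : minDistS (C : Set (Word 2 2 n)) = d₁)
    (hd₂ : minDistS (D : Set (Word 2 2 n)) = d₂)
    (hd' : minDistS ((dualH n C : Submodule (GaloisField 2 2) (Word 2 2 n)) :
        Set (Word 2 2 n)) = d')
    (hsub : C ≤ D) :
    (∃ Q : Submodule ℂ (QV 2 2 n), IsAQEC 2 2 n Q (4 ^ (k₂ - k₁)) d' d₂) ∧
    (∃ Q : Submodule ℂ (QV 2 2 n), IsAQEC 2 2 n Q (4 ^ (k₂ - k₁)) d₂ d') := by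
  subst hk₁ hk₂ hd₂ hd'
  refine ⟨⟨_, css_isAQEC C D hsub _ _ (fun a ha h0 => minDistS_le ha h0) (dual_wt C)⟩, ?_⟩
  have hle : (dotB n).orthogonal D ≤ (dotB n).orthogonal C :=
    LinearMap.BilinForm.orthogonal_le hsub
  have hfr : Module.finrank (GaloisField 2 2) ((dotB n).orthogonal C) -
      Module.finrank (GaloisField 2 2) ((dotB n).orthogonal D) =
      Module.finrank (GaloisField 2 2) D - Module.finrank (GaloisField 2 2) C := by
    rw [LinearMap.BilinForm.finrank_orthogonal (dotB_nondeg n),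
      LinearMap.BilinForm.finrank_orthogonal (dotB_nondeg n)]
    have h1 := Submodule.finrank_le D
    have h2 := Submodule.finrank_mono hsub
    omega
  rw [← hfr]
  refine ⟨_, css_isAQEC _ _ hle _ _ (fun a ha h0 => ?_) (fun b hb h0 => ?_)⟩
  · refine dual_wt C a (fun c hc => ?_) h0
    rw [dotW_comm, ← dotB_apply]
    exact ha c hc
  · refine minDistS_le ?_ h0
    change b ∈ D
    rw [← LinearMap.BilinForm.orthogonal_orthogonal (dotB_nondeg n) (dotB_refl n) D]
    intro c hc
    change dotB n c b = 0
    rw [dotB_apply, dotW_comm]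
    exact hb c hc
end AQC
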